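/- Let k be a field, L a Lie algebra over k, V a Lie module over L, and w ∈ V a nonzero vector such that the smallest L-submodule of V containing w is all of V. Let x ∈ L satisfy ⁅x, ⁅x, y⁆⁆ = 0 for every y ∈ L, and suppose x · w = 0. Then x acts locally nilpotently on V: for every v ∈ V there exists N ∈ ℕ with x^N · v = 0 (x applied N times to v is zero). -/

import Mathlib

/-- If `x ∈ L` satisfies `⁅x, ⁅x, y⁆⁆ = 0` for all `y ∈ L` and kills a
generator `w` of the `L`-module `V`, then `x` acts locally nilpotently on `V`. -/
theorem locally_nilpotent_of_kills_generator
    (k : Type*) [Field k]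
    (L : Type*) [LieRing L] [LieAlgebra k L]
    (V : Type*) [AddCommGroup V] [Module k V] [LieRingModule L V] [LieModule k L V]
    (w : V) (hw : w ≠ 0)
    (hgen : LieSubmodule.lieSpan k L ({w} : Set V) = ⊤)
    (x : L) (hx : ∀ y : L, ⁅x, ⁅x, y⁆⁆ = 0)
    (hxw : ⁅x, w⁆ = 0) :
    ∀ v : V, ∃ N : ℕ, ((LieModule.toEnd k L V x) ^ N) v = 0 := by
  suffices h : ∀ v : V, v ∈ (LieModule.toEnd k L V x).maxGenEigenspace 0 by
    intro v
    simpa [Module.End.mem_maxGenEigenspace] using h v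
  intro v
  have hv : v ∈ LieSubmodule.lieSpan k L ({w} : Set V) := hgen ▸ LieSubmodule.mem_top v
  induction hv using LieSubmodule.lieSpan_induction with
  | mem u hu =>
    obtain rfl : u = w := hu
    exact (Module.End.mem_maxGenEigenspace _ _ _).2 ⟨1, by simpa using hxw⟩
  | zero => exact zero_mem _
  | add _ _ _ _ ha hb => exact add_mem ha hb
  | smul a _ _ ha => exact Submodule.smul_mem _ a ha
  | lie y u _ hu =>
    have hy : y ∈ (LieModule.toEnd k L L x).maxGenEigenspace 0 :=
      (Module.End.mem_maxGenEigenspace _ _ _).2 ⟨2, by simpa [pow_two] using hx y⟩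
    simpa using LieModule.lie_mem_maxGenEigenspace_toEnd hy hu
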